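/- arXiv:2002.01654 — 2 statements merged into one kernel-verified Lean document; each statement's English description precedes it below -/
import Mathlib

section
/- For every β > 1 one has b(β) > −π/2. -/
open Set Filter

/-- `u` is a solution of the ODE `u'' + h u' + λ(|u|^{q-1} u - u) = 0`,
being C¹ on the closed set `S` (with derivative `u'`) and C² on `Sint`
(with second derivative `u''`), where the equation holds on `Sint`. -/
def SolOn (h : ℝ → ℝ) (lam q : ℝ) (S Sint : Set ℝ) (u u' u'' : ℝ → ℝ) : Prop :=
  (∀ t ∈ S, HasDerivWithinAt u (u' t) S t) ∧
  ContinuousOn u' S ∧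
  (∀ t ∈ Sint, HasDerivWithinAt u' (u'' t) Sint t) ∧
  ContinuousOn u'' Sint ∧
  (∀ t ∈ Sint, u'' t + h t * u' t + lam * (|u t| ^ (q - 1) * u t - u t) = 0)

/-- The Euclidean norm on ℝ². -/
noncomputable def enorm2 (p : ℝ × ℝ) : ℝ := Real.sqrt (p.1 ^ 2 + p.2 ^ 2)

/-- The nonlinearity `|x|^{q-1} x - x`. -/
noncomputable def nonlin (q x : ℝ) : ℝ := |x| ^ (q - 1) * x - x

/-- The primitive of `nonlin q` vanishing at `0`. -/
noncomputable def nonlinPrim (q x : ℝ) : ℝ := |x| ^ (q + 1) / (q + 1) - x ^ 2 / 2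

lemma hasDerivAt_nonlinPrim {q : ℝ} (hq : 1 < q) (x : ℝ) :
    HasDerivAt (nonlinPrim q) (nonlin q x) x := by
  have h1 := (hasDerivAt_abs_rpow x (p := q + 1) (by linarith)).div_const (q + 1)
  have h2 := (hasDerivAt_pow 2 x).div_const 2
  refine (h1.sub h2).congr_deriv ?_
  have : q + 1 ≠ 0 := by linarith
  have e : q + 1 - 2 = q - 1 := by ring
  rw [nonlin, e]
  field_simp
  norm_num
  ring

lemma hasDerivAt_abs_rpow_mul_self {q : ℝ} (hq : 1 < q) (x : ℝ) :
    HasDerivAt (fun y : ℝ => |y| ^ (q - 1) * y) (q * |x| ^ (q - 1)) x := by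
  rcases eq_or_ne x 0 with rfl | hx
  · rw [hasDerivAt_iff_tendsto_slope]
    have hc : Continuous fun y : ℝ => |y| ^ (q - 1) :=
      continuous_abs.rpow_const fun _ => Or.inr (by linarith)
    have h0 : q * |(0 : ℝ)| ^ (q - 1) = |(0 : ℝ)| ^ (q - 1) := by
      simp [Real.zero_rpow (by linarith : q - 1 ≠ 0)]
    rw [h0]
    refine (hc.continuousAt.mono_left nhdsWithin_le_nhds).congr' ?_
    filter_upwards [self_mem_nhdsWithin] with y hy
    have hy : y ≠ 0 := hy
    simp only [slope_def_field, mul_zero, sub_zero]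
    field_simp
  · have h1 := (hasDerivAt_abs hx).rpow_const (p := q - 1) (Or.inl (abs_ne_zero.2 hx))
    refine (h1.mul (hasDerivAt_id x)).congr_deriv ?_
    have h2 : |x| ^ (q - 1) = |x| ^ (q - 1 - 1) * |x| := by
      rw [← Real.rpow_add_one (abs_ne_zero.2 hx)]; ring_nf
    have h3 : (SignType.sign x : ℝ) * x = |x| := sign_mul_self x
    simp only [id, mul_one]
    rw [h2, ← h3]
    ring

lemma nonlin_lipschitz {q B x y : ℝ} (hq : 1 < q) (hx : |x| ≤ B) (hy : |y| ≤ B) :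
    |nonlin q x - nonlin q y| ≤ (q * B ^ (q - 1) + 1) * |x - y| := by
  have hd : ∀ z ∈ Icc (-B) B, HasDerivWithinAt (nonlin q) (q * |z| ^ (q - 1) - 1)
      (Icc (-B) B) z := fun z _ =>
    ((hasDerivAt_abs_rpow_mul_self hq z).sub (hasDerivAt_id z)).hasDerivWithinAt
  have hb : ∀ z ∈ Icc (-B) B, ‖q * |z| ^ (q - 1) - 1‖ ≤ q * B ^ (q - 1) + 1 := by
    intro z hz
    have h1 : |z| ^ (q - 1) ≤ B ^ (q - 1) :=
      Real.rpow_le_rpow (abs_nonneg _) (abs_le.2 hz) (by linarith)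
    have h2 : 0 ≤ |z| ^ (q - 1) := by positivity
    rw [Real.norm_eq_abs, abs_le]
    constructor <;> nlinarith
  simpa [Real.norm_eq_abs] using (convex_Icc (-B) B).norm_image_sub_le_of_norm_hasDerivWithin_le
    hd hb (abs_le.1 hy) (abs_le.1 hx)

lemma nonlinPrim_strictMonoOn {q : ℝ} (hq : 1 < q) : StrictMonoOn (nonlinPrim q) (Ici 1) := by
  refine strictMonoOn_of_deriv_pos (convex_Ici 1)
    (fun x _ => (hasDerivAt_nonlinPrim hq x).continuousAt.continuousWithinAt) fun x hx => ?_
  rw [interior_Ici] at hx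
  have hx : 1 < x := hx
  rw [(hasDerivAt_nonlinPrim hq x).deriv, nonlin, abs_of_pos (by linarith)]
  have := Real.one_lt_rpow hx (by linarith : 0 < q - 1)
  nlinarith

lemma abs_le_of_nonlinPrim_le {q x B : ℝ} (hq : 1 < q) (hB : 1 ≤ B)
    (hx : nonlinPrim q x ≤ nonlinPrim q B) : |x| ≤ B := by
  by_contra! hlt
  have h1 := nonlinPrim_strictMonoOn hq hB (hB.trans hlt.le : (1 : ℝ) ≤ |x|) hlt
  have h2 : nonlinPrim q |x| = nonlinPrim q x := by simp [nonlinPrim]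
  linarith

lemma monotoneOn_exp_mul {E E' : ℝ → ℝ} {K a b : ℝ} (hc : ContinuousOn E (Icc a b))
    (hd : ∀ t ∈ Ioo a b, HasDerivAt E (E' t) t) (hE : ∀ t ∈ Ioo a b, -(K * E t) ≤ E' t) :
    MonotoneOn (fun t => Real.exp (K * t) * E t) (Icc a b) := by
  refine monotoneOn_of_hasDerivWithinAt_nonneg (convex_Icc a b)
    (f' := fun t => Real.exp (K * t) * (K * E t + E' t)) (by fun_prop) (fun t ht => ?_)
    fun t ht => ?_
  · rw [interior_Icc] at ht
    have h1 : HasDerivAt (fun t => Real.exp (K * t)) (Real.exp (K * t) * (K * 1)) t :=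
      ((hasDerivAt_id t).const_mul K).exp
    exact ((h1.mul (hd t ht)).congr_deriv (by ring)).hasDerivWithinAt
  · rw [interior_Icc] at ht
    have := hE t ht
    exact mul_nonneg (Real.exp_pos _).le (by linarith)

/-- `u` with derivative `u'` solves `u'' + h u' + λ(|u|^{q-1} u - u) = 0` on `(a, d)` and is C¹ up
to the boundary. -/
structure IsSol (h : ℝ → ℝ) (lam q a d : ℝ) (u u' : ℝ → ℝ) : Prop where
  cont : ContinuousOn u (Icc a d)
  cont' : ContinuousOn u' (Icc a d)
  deriv : ∀ t ∈ Ioo a d, HasDerivAt u (u' t) t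
  deriv' : ∀ t ∈ Ioo a d, HasDerivAt u' (-(h t * u' t) - lam * nonlin q (u t)) t

lemma SolOn.isSol {h : ℝ → ℝ} {lam q a d : ℝ} {u u' u'' : ℝ → ℝ}
    (hs : SolOn h lam q (Icc a d) (Ico a d) u u' u'') : IsSol h lam q a d u u' := by
  obtain ⟨h1, h2, h3, -, h5⟩ := hs
  refine ⟨fun t ht => (h1 t ht).continuousWithinAt, h2,
    fun t ht => (h1 t (Ioo_subset_Icc_self ht)).hasDerivAt (Icc_mem_nhds ht.1 ht.2),
    fun t ht => ?_⟩
  refine ((h3 t (Ioo_subset_Ico_self ht)).hasDerivAt (Ico_mem_nhds ht.1 ht.2)).congr_deriv ?_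
  have := h5 t (Ioo_subset_Ico_self ht)
  rw [nonlin]
  linarith

namespace IsSol

variable {h : ℝ → ℝ} {lam q a d : ℝ} {u u' v v' : ℝ → ℝ}

lemma abs_le (hs : IsSol h lam q a d u u') (hq : 1 < q) (hlam : 0 < lam)
    (hneg : ∀ t ∈ Ioo a d, h t < 0) (hd1 : 1 ≤ u d) (hd0 : u' d = 0)
    {t : ℝ} (ht : t ∈ Icc a d) : |u t| ≤ u d := by
  have hGc : Continuous (nonlinPrim q) :=
    continuous_iff_continuousAt.2 fun x => (hasDerivAt_nonlinPrim hq x).continuousAt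
  have hm := monotoneOn_exp_mul (K := 0) (a := a) (b := d)
    (E := fun t => u' t ^ 2 / 2 + lam * nonlinPrim q (u t)) (E' := fun t => -(h t) * u' t ^ 2)
    (((hs.cont'.pow 2).div_const 2).add
      (continuousOn_const.mul (hGc.comp_continuousOn hs.cont)))
    (fun t ht => by
      have h1 := ((hs.deriv' t ht).pow 2).div_const 2
      have h2 := ((hasDerivAt_nonlinPrim hq (u t)).comp t (hs.deriv t ht)).const_mul lam
      refine (h1.add h2).congr_deriv ?_
      ring)
    (fun t ht => by
      have := hneg t ht
      have : 0 ≤ -(h t) * u' t ^ 2 := mul_nonneg (by linarith) (sq_nonneg _)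
      simpa using this)
  have hle := hm ht (right_mem_Icc.2 (ht.1.trans ht.2)) ht.2
  simp only [zero_mul, Real.exp_zero, one_mul, hd0] at hle
  refine abs_le_of_nonlinPrim_le hq hd1 ?_
  refine le_of_mul_le_mul_left ?_ hlam
  nlinarith [sq_nonneg (u' t)]

lemma sq_dist_le (hs : IsSol h lam q a d u u') (hv : IsSol h lam q a d v v') (hq : 1 < q)
    (hlam : 0 < lam) (hneg : ∀ t ∈ Ioo a d, h t < 0) {B : ℝ}
    (hu1 : 1 ≤ u d) (huB : u d ≤ B) (hu0 : u' d = 0)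
    (hv1 : 1 ≤ v d) (hvB : v d ≤ B) (hv0 : v' d = 0) {t : ℝ} (ht : t ∈ Icc a d) :
    (u t - v t) ^ 2 + (u' t - v' t) ^ 2 ≤
      Real.exp ((1 + lam * (q * B ^ (q - 1) + 1)) * (d - a)) * (u d - v d) ^ 2 := by
  set L := q * B ^ (q - 1) + 1 with hL
  have hL0 : 0 ≤ L := by
    have : 0 ≤ B ^ (q - 1) := Real.rpow_nonneg (by linarith) _
    nlinarith
  have hlL : 0 ≤ lam * L := by positivity
  have hm := monotoneOn_exp_mul (K := 1 + lam * L) (a := a) (b := d)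
    (E := fun t => (u t - v t) ^ 2 + (u' t - v' t) ^ 2)
    (E' := fun t => 2 * (u t - v t) * (u' t - v' t) + 2 * (u' t - v' t) *
      (-(h t * (u' t - v' t)) - lam * (nonlin q (u t) - nonlin q (v t))))
    (((hs.cont.sub hv.cont).pow 2).add ((hs.cont'.sub hv.cont').pow 2))
    (fun t ht => by
      have h1 := ((hs.deriv t ht).sub (hv.deriv t ht)).pow 2
      have h2 := ((hs.deriv' t ht).sub (hv.deriv' t ht)).pow 2
      refine (h1.add h2).congr_deriv ?_
      simp only [Pi.sub_apply, Nat.cast_ofNat]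
      ring)
    (fun t ht => by
      have hh := hneg t ht
      have ht' := Ioo_subset_Icc_self ht
      have hlip := nonlin_lipschitz hq ((hs.abs_le hq hlam hneg hu1 hu0 ht').trans huB)
        ((hv.abs_le hq hlam hneg hv1 hv0 ht').trans hvB)
      rw [← hL] at hlip
      set w := u t - v t
      set w' := u' t - v' t
      set D := nonlin q (u t) - nonlin q (v t)
      have h1 : w' * D ≤ L * (|w| * |w'|) := by
        calc w' * D ≤ |w' * D| := le_abs_self _
          _ = |D| * |w'| := by rw [abs_mul, mul_comm]
          _ ≤ L * |w| * |w'| := by gcongr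
          _ = _ := by ring
      have h2 : -(w * w') ≤ |w| * |w'| := by rw [← abs_mul]; exact neg_le_abs _
      have h3 : 2 * (|w| * |w'|) ≤ w ^ 2 + w' ^ 2 := by
        nlinarith [sq_nonneg (|w| - |w'|), sq_abs w, sq_abs w']
      have h4 : 0 ≤ -(h t) * w' ^ 2 := mul_nonneg (by linarith) (sq_nonneg _)
      have h5 := mul_le_mul_of_nonneg_left h1 hlam.le
      have h6 := mul_le_mul_of_nonneg_left h3 hlL
      nlinarith)
  have hle := hm ht (right_mem_Icc.2 (ht.1.trans ht.2)) ht.2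
  simp only [hu0, hv0, sub_self] at hle
  have hK : 0 ≤ 1 + lam * L := by linarith
  have e1 : Real.exp ((1 + lam * L) * (d - t)) ≤ Real.exp ((1 + lam * L) * (d - a)) :=
    Real.exp_le_exp.2 (mul_le_mul_of_nonneg_left (by linarith [ht.1]) hK)
  have e2 : Real.exp ((1 + lam * L) * d) =
      Real.exp ((1 + lam * L) * t) * Real.exp ((1 + lam * L) * (d - t)) := by
    rw [← Real.exp_add]; ring_nf
  rw [e2, mul_assoc] at hle
  have hle := le_of_mul_le_mul_left hle (Real.exp_pos _)
  refine hle.trans ?_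
  have : (u d - v d) ^ 2 + 0 ^ 2 = (u d - v d) ^ 2 := by ring
  rw [this]
  gcongr

lemma sq_add_sq_pos (hs : IsSol h lam q a d u u') (hq : 1 < q) (hlam : 0 < lam)
    (hcont : ContinuousOn h (Ico a d)) (hneg : ∀ t ∈ Ioo a d, h t < 0) (hd1 : 1 ≤ u d)
    (hd0 : u' d = 0) {t : ℝ} (ht : t ∈ Icc a d) : 0 < u t ^ 2 + u' t ^ 2 := by
  by_contra! hle
  have hut : u t ^ 2 + u' t ^ 2 = 0 := le_antisymm hle (by positivity)
  have htd : t < d := by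
    refine lt_of_le_of_ne ht.2 ?_
    rintro rfl
    nlinarith [sq_nonneg (u' t)]
  have hzero : ∀ s ∈ Ico t d, u s = 0 := by
    intro s hsd
    have hsub : Icc t s ⊆ Ico a d := fun x hx => ⟨ht.1.trans hx.1, hx.2.trans_lt hsd.2⟩
    obtain ⟨M, hM⟩ := isCompact_Icc.exists_bound_of_continuousOn (hcont.mono hsub)
    have hM0 : 0 ≤ M := (norm_nonneg _).trans (hM t (left_mem_Icc.2 hsd.1))
    set L := q * (u d) ^ (q - 1) + 1 with hL
    have hL0 : 0 ≤ L := by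
      have : 0 ≤ (u d) ^ (q - 1) := Real.rpow_nonneg (by linarith) _
      nlinarith
    have hlL : 0 ≤ lam * L := by positivity
    have hsub' : Icc t s ⊆ Icc a d := hsub.trans Ico_subset_Icc_self
    have hsubo : Ioo t s ⊆ Ioo a d := fun x hx => ⟨ht.1.trans_lt hx.1, hx.2.trans hsd.2⟩
    have hm := monotoneOn_exp_mul (K := -(1 + lam * L + 2 * M)) (a := t) (b := s)
      (E := fun t => -(u t ^ 2 + u' t ^ 2))
      (E' := fun t => -(2 * u t * u' t + 2 * u' t * (-(h t * u' t) - lam * nonlin q (u t))))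
      (((hs.cont.mono hsub').pow 2).add ((hs.cont'.mono hsub').pow 2)).neg
      (fun x hx => by
        have h1 := (hs.deriv x (hsubo hx)).pow 2
        have h2 := (hs.deriv' x (hsubo hx)).pow 2
        refine (h1.add h2).neg.congr_deriv ?_
        simp)
      (fun x hx => by
        have hlip := nonlin_lipschitz (y := 0) hq
          (hs.abs_le hq hlam hneg hd1 hd0 (hsub' (Ioo_subset_Icc_self hx))) (by simp; linarith)
        rw [← hL] at hlip
        simp only [nonlin, mul_zero, sub_zero] at hlip
        rw [← nonlin] at hlip
        have hMx := hM x (Ioo_subset_Icc_self hx)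
        rw [Real.norm_eq_abs] at hMx
        have hMx := (_root_.abs_le.1 hMx).1
        set w := u x
        set w' := u' x
        set D := nonlin q w
        have h1 : -(w' * D) ≤ L * (|w| * |w'|) := by
          calc -(w' * D) ≤ |w' * D| := neg_le_abs _
            _ = |D| * |w'| := by rw [abs_mul, mul_comm]
            _ ≤ L * |w| * |w'| := by gcongr
            _ = _ := by ring
        have h2 : w * w' ≤ |w| * |w'| := by rw [← abs_mul]; exact le_abs_self _
        have h3 : 2 * (|w| * |w'|) ≤ w ^ 2 + w' ^ 2 := by
          nlinarith [sq_nonneg (|w| - |w'|), sq_abs w, sq_abs w']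
        have h4 : 0 ≤ (M + h x) * w' ^ 2 := mul_nonneg (by linarith) (sq_nonneg _)
        have h5 := mul_le_mul_of_nonneg_left h1 hlam.le
        have h6 := mul_le_mul_of_nonneg_left h3 hlL
        have h7 : 0 ≤ M * w ^ 2 := by positivity
        nlinarith)
    have hle := hm (left_mem_Icc.2 hsd.1) (right_mem_Icc.2 hsd.1) hsd.1
    simp only [hut, neg_zero, mul_zero, mul_neg] at hle
    have h1 : u s ^ 2 + u' s ^ 2 ≤ 0 := by
      by_contra! hpos
      have := mul_pos (Real.exp_pos (-(1 + lam * L + 2 * M) * s)) hpos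
      simp only [neg_mul] at this hle
      linarith
    have h2 : u s ^ 2 = 0 := le_antisymm (by nlinarith [sq_nonneg (u' s)]) (sq_nonneg _)
    exact pow_eq_zero_iff (two_ne_zero) |>.1 h2
  have hcl : d ∈ closure (Ico t d) := by
    rw [closure_Ico htd.ne]; exact right_mem_Icc.2 htd.le
  have : (nhdsWithin d (Ico t d)).NeBot := mem_closure_iff_nhdsWithin_neBot.1 hcl
  have hlim : Tendsto u (nhdsWithin d (Ico t d)) (nhds (u d)) :=
    (hs.cont d (right_mem_Icc.2 (ht.1.trans ht.2))).mono
      fun x hx => ⟨ht.1.trans hx.1, hx.2.le⟩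
  have h0 : u d = 0 := tendsto_nhds_unique (hlim.congr' (f₂ := fun _ => (0 : ℝ))
    (eventually_nhdsWithin_of_forall hzero)) tendsto_const_nhds
  linarith

end IsSol

/-- Two continuous angle functions for the same direction which agree at one point agree. -/
lemma angle_eqOn {f g : ℝ → ℝ} {s : Set ℝ} (hs : IsPreconnected s) (hf : ContinuousOn f s)
    (hg : ContinuousOn g s) (hcos : ∀ x ∈ s, Real.cos (f x) = Real.cos (g x))
    (hsin : ∀ x ∈ s, Real.sin (f x) = Real.sin (g x)) {a : ℝ} (ha : a ∈ s) (hfa : f a = g a) :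
    ∀ x ∈ s, f x = g x := by
  intro x hx
  by_contra hne
  have hpos : 0 < |f x - g x| := abs_pos.2 (sub_ne_zero.2 hne)
  have hc : ContinuousOn (fun y => |f y - g y|) s := (hf.sub hg).abs
  have hmem : min |f x - g x| Real.pi ∈ Icc (|f a - g a|) (|f x - g x|) := by
    refine ⟨?_, min_le_left _ _⟩
    rw [hfa, sub_self, abs_zero]
    exact le_min hpos.le Real.pi_pos.le
  obtain ⟨y, hy, hyc⟩ := hs.intermediate_value ha hx hc hmem
  have h1 : Real.cos |f y - g y| = 1 := by
    rw [Real.cos_abs, Real.cos_sub, hcos y hy, hsin y hy]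
    nlinarith [Real.sin_sq_add_cos_sq (g y)]
  have h2 : 0 < |f y - g y| := by
    simp only at hyc
    rw [hyc]
    exact lt_min hpos Real.pi_pos
  have h3 : |f y - g y| ≤ Real.pi := hyc.trans_le (min_le_right _ _)
  have := (Real.cos_eq_one_iff_of_lt_of_lt (by linarith [Real.pi_pos])
    (by linarith [Real.pi_pos])).1 h1
  linarith

lemma eq_mul_cos_and_sin_of_exp {x y : ℝ} {z : ℂ} (hz : Complex.exp z = ⟨x, y⟩) :
    x = enorm2 (x, y) * Real.cos z.im ∧ y = enorm2 (x, y) * Real.sin z.im := by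
  have hx : Real.exp z.re * Real.cos z.im = x := by rw [← Complex.exp_re, hz]
  have hy : Real.exp z.re * Real.sin z.im = y := by rw [← Complex.exp_im, hz]
  have hn : enorm2 (x, y) = Real.exp z.re := by
    rw [enorm2, Real.sqrt_eq_iff_mul_self_eq (by positivity) (by positivity)]
    simp only [← hx, ← hy]
    linear_combination Real.exp z.re ^ 2 * (Real.sin_sq_add_cos_sq z.im)
  rw [hn]
  exact ⟨hx.symm, hy.symm⟩

/-- A continuous nonvanishing planar map on the rectangle `[a, b] × [c, d]` has a continuous
angle. -/
lemma exists_continuous_angle {a b c d : ℝ} (hab : a ≤ b) (hcd : c ≤ d) {U U' : ℝ × ℝ → ℝ}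
    (hU : ContinuousOn U (Icc a b ×ˢ Icc c d)) (hU' : ContinuousOn U' (Icc a b ×ˢ Icc c d))
    (hne : ∀ p ∈ Icc a b ×ˢ Icc c d, 0 < U p ^ 2 + U' p ^ 2)
    (h1 : U (a, d) = 1) (h0 : U' (a, d) = 0) :
    ∃ θ : ℝ × ℝ → ℝ, Continuous θ ∧ θ (a, d) = 0 ∧ ∀ p ∈ Icc a b ×ˢ Icc c d,
      U p = enorm2 (U p, U' p) * Real.cos (θ p) ∧
      U' p = enorm2 (U p, U' p) * Real.sin (θ p) := by
  set r : ℝ × ℝ → ℝ × ℝ := fun p => (projIcc a b hab p.1, projIcc c d hcd p.2) with hr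
  have hrc : Continuous r := by
    have := continuous_projIcc (h := hab)
    have := continuous_projIcc (h := hcd)
    fun_prop
  have hrm : ∀ p, r p ∈ Icc a b ×ˢ Icc c d := fun p => ⟨Subtype.coe_prop _, Subtype.coe_prop _⟩
  have hrid : ∀ p ∈ Icc a b ×ˢ Icc c d, r p = p := by
    rintro ⟨x, y⟩ ⟨hx, hy⟩
    simp only [hr]
    rw [projIcc_of_mem hab hx, projIcc_of_mem hcd hy]
  let f : C(ℝ × ℝ, ℂ) := ⟨fun p => ⟨U (r p), U' (r p)⟩, by
    have e : (fun p => (⟨U (r p), U' (r p)⟩ : ℂ)) =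
        fun p => Complex.equivRealProdCLM.symm (U (r p), U' (r p)) := by
      funext p
      rfl
    rw [e]
    exact Complex.equivRealProdCLM.symm.continuous.comp
      ((hU.comp_continuous hrc hrm).prodMk (hU'.comp_continuous hrc hrm))⟩
  have hrad : r (a, d) = (a, d) := hrid _ ⟨left_mem_Icc.2 hab, right_mem_Icc.2 hcd⟩
  obtain ⟨F, ⟨hF0, hF⟩, -⟩ := Complex.isCoveringMapOn_exp.existsUnique_continuousMap_lifts f
    (a₀ := (a, d)) (e₀ := 0) (by simp [f, hrad, h1, h0, Complex.ext_iff]) (by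
      intro p hp
      have h2 := hne _ (hrm p)
      have hp : (⟨U (r p), U' (r p)⟩ : ℂ) = 0 := hp
      rw [Complex.ext_iff] at hp
      have hp1 : U (r p) = 0 := hp.1
      have hp2 : U' (r p) = 0 := hp.2
      rw [hp1, hp2] at h2
      norm_num at h2)
  refine ⟨fun p => (F p).im, Complex.continuous_im.comp F.continuous, by simp [hF0],
    fun p hp => eq_mul_cos_and_sin_of_exp ?_⟩
  have h3 : Complex.exp (F p) = ⟨U (r p), U' (r p)⟩ := congrFun hF p
  rw [h3, hrid p hp]

/-- In backward time, the angle of `(u, u')` can only increase through `-π/2`. -/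
lemma neg_pi_div_two_lt_angle {a d : ℝ} (had : a ≤ d) {u u' ψ r : ℝ → ℝ}
    (hd : ∀ t ∈ Icc a d, HasDerivWithinAt u (u' t) (Icc a d) t)
    (hψ : ContinuousOn ψ (Icc a d)) (hψd : ψ d = 0) (hr : ∀ t ∈ Icc a d, 0 < r t)
    (hu : ∀ t ∈ Icc a d, u t = r t * Real.cos (ψ t))
    (hu' : ∀ t ∈ Icc a d, u' t = r t * Real.sin (ψ t)) : -(Real.pi / 2) < ψ a := by
  by_contra! hle
  have hpi := Real.pi_pos
  obtain ⟨s, ⟨hs, hψs⟩, hmax⟩ : ∃ s, (s ∈ Icc a d ∧ ψ s = -(Real.pi / 2)) ∧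
      ∀ t ∈ Ioc s d, -(Real.pi / 2) < ψ t := by
    have hcpt : IsCompact (Icc a d ∩ ψ ⁻¹' Iic (-(Real.pi / 2))) :=
      isCompact_Icc.of_isClosed_subset (hψ.preimage_isClosed_of_isClosed isClosed_Icc isClosed_Iic)
        inter_subset_left
    obtain ⟨s, ⟨hs, hψs⟩, hub⟩ := hcpt.exists_isGreatest ⟨a, left_mem_Icc.2 had, hle⟩
    refine ⟨s, ⟨hs, ?_⟩, fun t ht => ?_⟩
    · obtain ⟨y, hy, hyv⟩ := intermediate_value_Icc hs.2 (hψ.mono (Icc_subset_Icc_left hs.1))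
        (⟨hψs, by rw [hψd]; linarith⟩ : -(Real.pi / 2) ∈ Icc (ψ s) (ψ d))
      have : y ≤ s := hub ⟨⟨hs.1.trans hy.1, hy.2⟩, hyv.le⟩
      rwa [← le_antisymm this hy.1]
    · by_contra! hlt
      have := hub ⟨⟨hs.1.trans ht.1.le, ht.2⟩, hlt⟩
      linarith [ht.1]
  have hsd : s < d := by
    refine lt_of_le_of_ne hs.2 ?_
    rintro rfl
    linarith
  have hus : u s = 0 := by rw [hu s hs, hψs]; simp
  have hus' : u' s < 0 := by rw [hu' s hs, hψs]; simpa using hr s hs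
  have hsub : Ioc s d ⊆ Icc a d := fun x hx => ⟨hs.1.trans hx.1.le, hx.2⟩
  have : (nhdsWithin s (Ioc s d)).NeBot := by
    apply mem_closure_iff_nhdsWithin_neBot.1
    rw [closure_Ioc hsd.ne]
    exact left_mem_Icc.2 hsd.le
  have hslope := (hasDerivWithinAt_iff_tendsto_slope' (by simp)).1 ((hd s hs).mono hsub)
  have hψlt : ∀ᶠ t in nhdsWithin s (Ioc s d), ψ t < Real.pi / 2 :=
    ((hψ s hs).mono hsub).eventually_lt_const (by rw [hψs]; linarith)
  refine absurd (ge_of_tendsto hslope ?_) (not_le.2 hus')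
  filter_upwards [hψlt, self_mem_nhdsWithin] with t h1 ht
  rw [slope_def_field, hus, sub_zero, hu t (hsub ht)]
  have h2 := Real.cos_nonneg_of_mem_Icc ⟨(hmax t ht).le, h1.le⟩
  exact div_nonneg (mul_nonneg (hr t (hsub ht)).le h2) (by linarith [ht.1])

theorem stmt_12
    (d lam : ℝ) (hd : 0 < d) (hlam : 0 < lam)
    (n m₁ m₂ : ℤ) (hn : 3 ≤ n)
    (hm₁0 : 0 ≤ m₁) (hm₁n : m₁ ≤ n - 2) (hm₂0 : 0 ≤ m₂) (hm₂n : m₂ ≤ n - 2)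
    (h : ℝ → ℝ) (hC1 : ContDiffOn ℝ 1 h (Set.Ioo 0 d))
    (hder : ∀ t ∈ Set.Ioo 0 d, deriv h t < 0)
    (hlim0 : Filter.Tendsto (fun t => t * h t) (nhdsWithin 0 (Set.Ioi 0))
      (nhds ((n : ℝ) - (m₁ : ℝ) - 1)))
    (hlimd : Filter.Tendsto (fun t => (t - d) * h t) (nhdsWithin d (Set.Iio d))
      (nhds ((n : ℝ) - (m₂ : ℝ) - 1)))
    (q : ℝ) (hq1 : 1 < q)
    (t₀ : ℝ) (ht₀ : t₀ ∈ Set.Ioo 0 d)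
    (hpos : ∀ t ∈ Set.Ioo 0 t₀, 0 < h t) (hneg : ∀ t ∈ Set.Ioo t₀ d, h t < 0)
    (V V' V'' : ℝ → ℝ → ℝ)
    (hV : ∀ β : ℝ, SolOn h lam q (Set.Icc t₀ d) (Set.Ico t₀ d) (V β) (V' β) (V'' β) ∧
      V β d = β ∧ V' β d = 0)
    (hVuniq : ∀ β : ℝ, ∀ u u' u'' : ℝ → ℝ,
      SolOn h lam q (Set.Icc t₀ d) (Set.Ico t₀ d) u u' u'' → u d = β → u' d = 0 →
      ∀ t ∈ Set.Icc t₀ d, u t = V β t ∧ u' t = V' β t)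
    (b : ℝ → ℝ) (hbCont : ContinuousOn b (Set.Ioi 0)) (hb1 : b 1 = 0)
    (hbAngle : ∀ β : ℝ, 0 < β →
      V β t₀ = enorm2 (V β t₀, V' β t₀) * Real.cos (b β) ∧
      V' β t₀ = enorm2 (V β t₀, V' β t₀) * Real.sin (b β))
    :
    ∀ β : ℝ, 1 < β → -(Real.pi / 2) < b β := by
  intro β hβ
  have htd : t₀ ≤ d := ht₀.2.le
  have hs : ∀ γ, IsSol h lam q t₀ d (V γ) (V' γ) := fun γ => (hV γ).1.isSol
  have hcont : ContinuousOn h (Ico t₀ d) :=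
    hC1.continuousOn.mono fun t ht => ⟨ht₀.1.trans_le ht.1, ht.2⟩
  have hVd : ∀ γ, V γ d = γ := fun γ => (hV γ).2.1
  have hV'd : ∀ γ, V' γ d = 0 := fun γ => (hV γ).2.2
  have hV1 : ∀ t ∈ Icc t₀ d, (1 : ℝ) = V 1 t ∧ (0 : ℝ) = V' 1 t :=
    hVuniq 1 (fun _ => 1) (fun _ => 0) (fun _ => 0)
      ⟨fun t _ => hasDerivWithinAt_const _ _ _, continuousOn_const,
        fun t _ => hasDerivWithinAt_const _ _ _, continuousOn_const, by simp⟩ rfl rfl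
  set C := Real.exp ((1 + lam * (q * β ^ (q - 1) + 1)) * (d - t₀)) with hC
  have hdist : ∀ t ∈ Icc t₀ d, ∀ x ∈ Icc 1 β, ∀ y ∈ Icc 1 β,
      (V x t - V y t) ^ 2 + (V' x t - V' y t) ^ 2 ≤ C * (x - y) ^ 2 := by
    intro t ht x hx y hy
    have := (hs x).sq_dist_le (hs y) hq1 hlam hneg (B := β) (by rw [hVd]; exact hx.1)
      (by rw [hVd]; exact hx.2) (hV'd x) (by rw [hVd]; exact hy.1)
      (by rw [hVd]; exact hy.2) (hV'd y) ht
    rwa [hVd, hVd] at this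
  have hsqrt : ∀ z w : ℝ, z ^ 2 ≤ C * w ^ 2 → |z| ≤ Real.sqrt C * |w| := by
    intro z w hzw
    rw [← Real.sqrt_sq_eq_abs w, ← Real.sqrt_mul (Real.exp_pos _).le]
    exact Real.abs_le_sqrt hzw
  have hjoint : ContinuousOn (fun p : ℝ × ℝ => V p.1 p.2) (Icc 1 β ×ˢ Icc t₀ d) :=
    continuousOn_prod_of_continuousOn_lipschitzOnWith _ (Real.toNNReal (Real.sqrt C))
      (fun x _ => (hs x).cont) fun t ht => LipschitzOnWith.of_dist_le' fun x hx y hy =>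
        hsqrt _ _ (by nlinarith [hdist t ht x hx y hy, sq_nonneg (V' x t - V' y t)])
  have hjoint' : ContinuousOn (fun p : ℝ × ℝ => V' p.1 p.2) (Icc 1 β ×ˢ Icc t₀ d) :=
    continuousOn_prod_of_continuousOn_lipschitzOnWith _ (Real.toNNReal (Real.sqrt C))
      (fun x _ => (hs x).cont') fun t ht => LipschitzOnWith.of_dist_le' fun x hx y hy =>
        hsqrt _ _ (by nlinarith [hdist t ht x hx y hy, sq_nonneg (V x t - V y t)])
  have hne : ∀ p ∈ Icc 1 β ×ˢ Icc t₀ d, 0 < V p.1 p.2 ^ 2 + V' p.1 p.2 ^ 2 := fun p hp =>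
    (hs p.1).sq_add_sq_pos hq1 hlam hcont hneg (by rw [hVd]; exact hp.1.1) (hV'd _) hp.2
  have hnorm : ∀ p ∈ Icc 1 β ×ˢ Icc t₀ d, 0 < enorm2 (V p.1 p.2, V' p.1 p.2) := fun p hp =>
    Real.sqrt_pos.2 (hne p hp)
  obtain ⟨θ, hθ, hθ0, hθa⟩ := exists_continuous_angle hβ.le htd hjoint hjoint' hne (hVd 1) (hV'd 1)
  have hcancel : ∀ p ∈ Icc 1 β ×ˢ Icc t₀ d, ∀ φ : ℝ,
      V p.1 p.2 = enorm2 (V p.1 p.2, V' p.1 p.2) * Real.cos φ →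
      V' p.1 p.2 = enorm2 (V p.1 p.2, V' p.1 p.2) * Real.sin φ →
      Real.cos (θ p) = Real.cos φ ∧ Real.sin (θ p) = Real.sin φ := fun p hp φ h1 h2 =>
    ⟨mul_left_cancel₀ (hnorm p hp).ne' ((hθa p hp).1.symm.trans h1),
      mul_left_cancel₀ (hnorm p hp).ne' ((hθa p hp).2.symm.trans h2)⟩
  have h1mem : (1 : ℝ) ∈ Icc 1 β := left_mem_Icc.2 hβ.le
  have hβmem : β ∈ Icc 1 β := right_mem_Icc.2 hβ.le
  have ht₀mem : t₀ ∈ Icc t₀ d := left_mem_Icc.2 htd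
  have hdmem : d ∈ Icc t₀ d := right_mem_Icc.2 htd
  have hθ1 : ∀ t ∈ Icc t₀ d, θ (1, t) = 0 := by
    have key : ∀ t ∈ Icc t₀ d, Real.cos (θ (1, t)) = Real.cos 0 ∧
        Real.sin (θ (1, t)) = Real.sin 0 := fun t ht =>
      hcancel (1, t) ⟨h1mem, ht⟩ 0 (by simp [enorm2, ← hV1 t ht]) (by simp [← hV1 t ht])
    exact angle_eqOn (g := fun _ => 0) isPreconnected_Icc (by fun_prop) continuousOn_const
      (fun t ht => (key t ht).1) (fun t ht => (key t ht).2) hdmem hθ0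
  have hθd : ∀ x ∈ Icc 1 β, θ (x, d) = 0 := by
    have key : ∀ x ∈ Icc 1 β, Real.cos (θ (x, d)) = Real.cos 0 ∧
        Real.sin (θ (x, d)) = Real.sin 0 := fun x hx =>
      hcancel (x, d) ⟨hx, hdmem⟩ 0
        (by simp [enorm2, hVd, hV'd, Real.sqrt_sq (zero_le_one.trans hx.1)]) (by simp [hV'd])
    exact angle_eqOn (f := fun x => θ (x, d)) (g := fun _ => 0) isPreconnected_Icc (by fun_prop)
      continuousOn_const (fun t ht => (key t ht).1) (fun t ht => (key t ht).2) h1mem hθ0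
  have hθb : ∀ x ∈ Icc 1 β, θ (x, t₀) = b x := by
    have key : ∀ x ∈ Icc 1 β, Real.cos (θ (x, t₀)) = Real.cos (b x) ∧
        Real.sin (θ (x, t₀)) = Real.sin (b x) := fun x hx =>
      have hb := hbAngle x (zero_lt_one.trans_le hx.1)
      hcancel (x, t₀) ⟨hx, ht₀mem⟩ _ hb.1 hb.2
    exact angle_eqOn (f := fun x => θ (x, t₀)) isPreconnected_Icc (by fun_prop)
      (hbCont.mono fun x hx => zero_lt_one.trans_le hx.1) (fun t ht => (key t ht).1)
      (fun t ht => (key t ht).2) h1mem ((hθ1 t₀ ht₀mem).trans hb1.symm)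
  rw [← hθb β hβmem]
  exact neg_pi_div_two_lt_angle (ψ := fun t => θ (β, t))
    (r := fun t => enorm2 (V β t, V' β t)) htd (hV β).1.1 (by fun_prop) (hθd β hβmem)
    (fun t ht => hnorm (β, t) ⟨hβmem, ht⟩) (fun t ht => (hθa (β, t) ⟨hβmem, ht⟩).1)
    fun t ht => (hθa (β, t) ⟨hβmem, ht⟩).2
end

section
/- If α > 1 and β > 1 satisfy a(α) = b(β) and |I(α)| = |F(β)|, then I(α) = F(β), and the function u : [0,d] → ℝ defined by u(t) = u_α(t) for t ∈ [0,t₀] and u(t) = u*_β(t) for t ∈ [t₀,d] belongs to C¹([0,d]) ∩ C²((0,d)), satisfies equation (★) on (0,d), satisfies u'(0) = u'(d) = 0, and is positive: u(t) > 0 for all t ∈ [0,d]. -/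
open Set Filter

section Helpers

open Real Topology

/-- Grönwall's inequality on a closed interval, with differentiability only in the interior. -/
theorem le_mul_exp_of_hasDerivAt_le {f f' : ℝ → ℝ} {x y C : ℝ} (hxy : x ≤ y)
    (hf : ContinuousOn f (Icc x y)) (hf' : ∀ t ∈ Ioo x y, HasDerivAt f (f' t) t)
    (hle : ∀ t ∈ Ioo x y, f' t ≤ C * f t) : f y ≤ f x * exp (C * (y - x)) := by
  have hanti : AntitoneOn (fun t => f t * exp (-C * t)) (Icc x y) := by
    have hd : ∀ t ∈ Ioo x y, HasDerivAt (fun t => f t * exp (-C * t))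
        (f' t * exp (-C * t) + f t * (exp (-C * t) * (-C * 1))) t := fun t ht =>
      (hf' t ht).mul (((hasDerivAt_id t).const_mul (-C)).exp)
    refine antitoneOn_of_deriv_nonpos (convex_Icc x y) (hf.mul (by fun_prop)) ?_ ?_
    · rw [interior_Icc]
      exact fun t ht => (hd t ht).differentiableAt.differentiableWithinAt
    · rw [interior_Icc]
      intro t ht
      rw [(hd t ht).deriv]
      have h1 := hle t ht
      have h2 := exp_pos (-C * t)
      nlinarith
  have h1 : f y * exp (-C * y) ≤ f x * exp (-C * x) :=
    hanti (left_mem_Icc.2 hxy) (right_mem_Icc.2 hxy) hxy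
  have h2 := mul_le_mul_of_nonneg_right h1 (exp_pos (C * y)).le
  rw [mul_assoc, mul_assoc, ← exp_add, ← exp_add] at h2
  rwa [show -C * y + C * y = 0 by ring, exp_zero, mul_one,
    show -C * x + C * y = C * (y - x) by ring] at h2

theorem exists_lipschitz_abs_rpow_sub {q : ℝ} (hq : 1 < q) (M : ℝ) :
    ∃ L, 0 ≤ L ∧ ∀ x y : ℝ, |x| ≤ M → |y| ≤ M →
      |(|x| ^ (q - 1) * x - x) - (|y| ^ (q - 1) * y - y)| ≤ L * |x - y| := by
  have hc : ContDiff ℝ 1 (fun x : ℝ => x ^ q) := contDiff_rpow_const_of_le (by exact_mod_cast hq.le)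
  have hcd : Continuous (deriv fun x : ℝ => x ^ q) := hc.continuous_deriv le_rfl
  obtain ⟨K, hK⟩ := isCompact_Icc.exists_bound_of_continuousOn (hcd.continuousOn (s := Icc 0 M))
  have hlip : ∀ x ∈ Icc 0 M, ∀ y ∈ Icc 0 M, |x ^ q - y ^ q| ≤ K * |x - y| := fun x hx y hy =>
    (convex_Icc 0 M).norm_image_sub_le_of_norm_deriv_le
      (fun t _ => (hc.differentiable (by simp)).differentiableAt) hK hy hx
  have hsplit : ∀ x : ℝ, |x| ^ (q - 1) * x = (max x 0) ^ q - (max (-x) 0) ^ q := by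
    intro x
    have h0 : (0 : ℝ) ^ q = 0 := zero_rpow (by linarith)
    rcases lt_trichotomy x 0 with hx | rfl | hx
    · rw [abs_of_neg hx, max_eq_right hx.le, max_eq_left (by linarith), h0,
        rpow_sub_one (by linarith)]
      field_simp [hx.ne]
      ring
    · simp [h0]
    · rw [abs_of_pos hx, max_eq_left hx.le, max_eq_right (by linarith), h0, rpow_sub_one hx.ne']
      field_simp [hx.ne]
      ring
  refine ⟨2 * |K| + 1, by positivity, fun x y hx hy => ?_⟩
  rw [hsplit, hsplit]
  have hM : 0 ≤ M := (abs_nonneg x).trans hx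
  obtain ⟨hx1, hx2⟩ := abs_le.1 hx
  obtain ⟨hy1, hy2⟩ := abs_le.1 hy
  have h1 := hlip (max x 0) ⟨le_max_right _ _, max_le hx2 hM⟩
    (max y 0) ⟨le_max_right _ _, max_le hy2 hM⟩
  have h2 := hlip (max (-x) 0) ⟨le_max_right _ _, max_le (by linarith) hM⟩
    (max (-y) 0) ⟨le_max_right _ _, max_le (by linarith) hM⟩
  have h3 : |max x 0 - max y 0| ≤ |x - y| := abs_max_sub_max_le_abs x y 0
  have h4 : |max (-x) 0 - max (-y) 0| ≤ |x - y| := by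
    refine (abs_max_sub_max_le_abs (-x) (-y) 0).trans_eq ?_
    rw [← abs_neg]
    ring_nf
  have h5 : K * |max x 0 - max y 0| ≤ |K| * |x - y| :=
    mul_le_mul (le_abs_self K) h3 (abs_nonneg _) (abs_nonneg _)
  have h6 : K * |max (-x) 0 - max (-y) 0| ≤ |K| * |x - y| :=
    mul_le_mul (le_abs_self K) h4 (abs_nonneg _) (abs_nonneg _)
  rw [abs_le] at *
  have h7 := le_abs_self (x - y)
  have h8 := neg_abs_le (x - y)
  constructor <;> linarith [h1.1, h1.2, h2.1, h2.2]

section SolOn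

variable {h : ℝ → ℝ} {lam q T : ℝ} {u u' u'' w w' w'' : ℝ → ℝ}

theorem SolOn.continuousOn {S Sint : Set ℝ} (hu : SolOn h lam q S Sint u u' u'') :
    ContinuousOn u S := fun t ht => (hu.1 t ht).continuousWithinAt

theorem SolOn.hasDerivAt (hu : SolOn h lam q (Icc 0 T) (Ioc 0 T) u u' u'') {t : ℝ}
    (ht : t ∈ Ioo 0 T) : HasDerivAt u (u' t) t :=
  (hu.1 t (Ioo_subset_Icc_self ht)).hasDerivAt (Icc_mem_nhds ht.1 ht.2)

theorem SolOn.hasDerivAt' (hu : SolOn h lam q (Icc 0 T) (Ioc 0 T) u u' u'') {t : ℝ}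
    (ht : t ∈ Ioo 0 T) : HasDerivAt u' (u'' t) t :=
  (hu.2.2.1 t (Ioo_subset_Ioc_self ht)).hasDerivAt (Ioc_mem_nhds ht.1 ht.2)

theorem SolOn.eqn {S Sint : Set ℝ} (hu : SolOn h lam q S Sint u u' u'') {t : ℝ}
    (ht : t ∈ Sint) : u'' t = -(h t * u' t) - lam * (|u t| ^ (q - 1) * u t - u t) := by
  linarith [hu.2.2.2.2 t ht]

/-- The energy is nonincreasing, so a solution with initial height at least `1` stays below it. -/
theorem SolOn.abs_le (hlam : 0 < lam) (hq : 1 < q) (hh : ∀ t ∈ Ioo 0 T, 0 ≤ h t)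
    (hu : SolOn h lam q (Icc 0 T) (Ioc 0 T) u u' u'') (hu0 : 1 ≤ u 0) (hu'0 : u' 0 = 0)
    {t : ℝ} (ht : t ∈ Icc 0 T) : |u t| ≤ u 0 := by
  set G : ℝ → ℝ := fun x => |x| ^ (q + 1) / (q + 1) - x ^ 2 / 2 with hG
  have hGd : ∀ x, HasDerivAt G (|x| ^ (q - 1) * x - x) x := by
    intro x
    have h1 := ((hasDerivAt_abs_rpow x (p := q + 1) (by linarith)).div_const (q + 1)).sub
      (((hasDerivAt_id x).pow 2).div_const 2)
    refine h1.congr_deriv ?_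
    rw [show q + 1 - 2 = q - 1 by ring]
    have : q + 1 ≠ 0 := by linarith
    field_simp
    simp
    ring
  have hGc : Continuous G := continuous_iff_continuousAt.2 fun x => (hGd x).continuousAt
  have hGmono : StrictMonoOn G (Ici 1) := by
    refine strictMonoOn_of_deriv_pos (convex_Ici 1) hGc.continuousOn ?_
    rw [interior_Ici]
    intro x hx
    have hx : 1 < x := hx
    rw [(hGd x).deriv, abs_of_pos (by linarith)]
    have := one_lt_rpow hx (show 0 < q - 1 by linarith)
    nlinarith
  have hEle := le_mul_exp_of_hasDerivAt_le (C := 0) (f := fun s => u' s ^ 2 / 2 + lam * G (u s))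
    (f' := fun s => 2 * u' s * u'' s / 2 + lam * ((|u s| ^ (q - 1) * u s - u s) * u' s)) ht.1
    ?_ ?_ ?_
  · simp only [hu'0, zero_mul, exp_zero, mul_one] at hEle
    have hle : G (u t) ≤ G (u 0) := by
      have : lam * G (u t) ≤ lam * G (u 0) := by nlinarith [sq_nonneg (u' t)]
      exact le_of_mul_le_mul_left this hlam
    by_contra! hlt
    have h1 := hGmono (show (1 : ℝ) ≤ u 0 from hu0) (show (1 : ℝ) ≤ |u t| by linarith) hlt
    have h2 : G |u t| = G (u t) := by simp [hG]
    linarith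
  · have hsub : Icc 0 t ⊆ Icc 0 T := Icc_subset_Icc_right ht.2
    exact (((hu.2.1.mono hsub).pow 2).div_const 2).add
      (continuousOn_const.mul (hGc.comp_continuousOn (hu.continuousOn.mono hsub)))
  · intro s hs
    have hs : s ∈ Ioo 0 T := ⟨hs.1, hs.2.trans_le ht.2⟩
    have h1 := (((hu.hasDerivAt' hs).pow 2).div_const 2).add
      (((hGd (u s)).comp s (hu.hasDerivAt hs)).const_mul lam)
    refine h1.congr_deriv ?_
    simp
  · intro s hs
    have hs : s ∈ Ioo 0 T := ⟨hs.1, hs.2.trans_le ht.2⟩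
    rw [hu.eqn (Ioo_subset_Ioc_self hs)]
    nlinarith [mul_nonneg (hh s hs) (sq_nonneg (u' s))]

/-- Continuous dependence on the initial height, despite the singularity of `h` at `0`. -/
theorem SolOn.dist_sq_le (hlam : 0 < lam) (hh : ∀ t ∈ Ioo 0 T, 0 ≤ h t) {M L : ℝ} (hL : 0 ≤ L)
    (hLip : ∀ x y : ℝ, |x| ≤ M → |y| ≤ M →
      |(|x| ^ (q - 1) * x - x) - (|y| ^ (q - 1) * y - y)| ≤ L * |x - y|)
    (hu : SolOn h lam q (Icc 0 T) (Ioc 0 T) u u' u'')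
    (hw : SolOn h lam q (Icc 0 T) (Ioc 0 T) w w' w'')
    (huM : ∀ t ∈ Icc 0 T, |u t| ≤ M) (hwM : ∀ t ∈ Icc 0 T, |w t| ≤ M)
    (hu'0 : u' 0 = 0) (hw'0 : w' 0 = 0) {t : ℝ} (ht : t ∈ Icc 0 T) :
    (u t - w t) ^ 2 + (u' t - w' t) ^ 2 ≤ (u 0 - w 0) ^ 2 * exp ((1 + lam * L) * T) := by
  have key := le_mul_exp_of_hasDerivAt_le (C := 1 + lam * L)
    (f := fun s => (u s - w s) ^ 2 + (u' s - w' s) ^ 2)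
    (f' := fun s => 2 * (u s - w s) * (u' s - w' s) + 2 * (u' s - w' s) * (u'' s - w'' s)) ht.1
    ?_ ?_ ?_
  · simp only [hu'0, hw'0, sub_zero] at key
    refine key.trans ?_
    norm_num
    gcongr
    exact ht.2
  · have hsub : Icc 0 t ⊆ Icc 0 T := Icc_subset_Icc_right ht.2
    exact (((hu.continuousOn.sub hw.continuousOn).pow 2).add ((hu.2.1.sub hw.2.1).pow 2)).mono hsub
  · intro s hs
    have hs : s ∈ Ioo 0 T := ⟨hs.1, hs.2.trans_le ht.2⟩
    have h1 := (((hu.hasDerivAt hs).sub (hw.hasDerivAt hs)).pow 2).add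
      (((hu.hasDerivAt' hs).sub (hw.hasDerivAt' hs)).pow 2)
    refine h1.congr_deriv ?_
    simp
  · intro s hs
    have hs : s ∈ Ioo 0 T := ⟨hs.1, hs.2.trans_le ht.2⟩
    have hs' := Ioo_subset_Icc_self hs
    have hd := hLip _ _ (huM s hs') (hwM s hs')
    rw [hu.eqn (Ioo_subset_Ioc_self hs), hw.eqn (Ioo_subset_Ioc_self hs)]
    set A := |u s| ^ (q - 1) * u s - u s
    set B := |w s| ^ (q - 1) * w s - w s
    set x := u s - w s
    have h1 := mul_nonneg (hh s hs) (sq_nonneg (u' s - w' s))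
    have h2 : -((u' s - w' s) * (A - B)) ≤ L * (|x| * |u' s - w' s|) := by
      calc _ ≤ |(u' s - w' s) * (A - B)| := neg_le_abs _
        _ = |u' s - w' s| * |A - B| := abs_mul _ _
        _ ≤ |u' s - w' s| * (L * |x|) := by gcongr
        _ = _ := by ring
    have h3 : 2 * (|x| * |u' s - w' s|) ≤ x ^ 2 + (u' s - w' s) ^ 2 := by
      rw [← sq_abs x, ← sq_abs (u' s - w' s)]
      nlinarith [sq_nonneg (|x| - |u' s - w' s|)]
    have h4 : 2 * x * (u' s - w' s) ≤ x ^ 2 + (u' s - w' s) ^ 2 := by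
      nlinarith [sq_nonneg (x - (u' s - w' s))]
    have h5 := mul_le_mul_of_nonneg_left h2 hlam.le
    have h6 := mul_le_mul_of_nonneg_left h3 (mul_nonneg hlam.le hL)
    linear_combination h4 + 2 * h5 + h6 + 2 * h1

/-- Solutions with nonzero initial height never vanish together with their derivative. -/
theorem SolOn.sq_add_sq_pos (hlam : 0 < lam) (hq : 1 < q) (hhc : ContinuousOn h (Ioc 0 T))
    (hu : SolOn h lam q (Icc 0 T) (Ioc 0 T) u u' u'') (hu0 : u 0 ≠ 0)
    {t : ℝ} (ht : t ∈ Icc 0 T) : 0 < u t ^ 2 + u' t ^ 2 := by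
  by_contra! hle
  obtain ⟨M, hM⟩ := isCompact_Icc.exists_bound_of_continuousOn hu.continuousOn
  obtain ⟨L, hL, hLip⟩ := exists_lipschitz_abs_rpow_sub hq M
  have ht0 : 0 < t := by
    rcases ht.1.eq_or_lt with rfl | h0
    · have := pow_pos (abs_pos.2 hu0) 2
      rw [sq_abs] at this
      linarith [sq_nonneg (u' 0)]
    · exact h0
  have hzero : ∀ s ∈ Ioo 0 t, u s = 0 := by
    intro s hs
    have hsub : Icc s t ⊆ Icc 0 T := Icc_subset_Icc hs.1.le ht.2
    obtain ⟨H, hH⟩ := isCompact_Icc.exists_bound_of_continuousOn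
      (hhc.mono (show Icc s t ⊆ Ioc 0 T from fun x hx => ⟨hs.1.trans_le hx.1, hx.2.trans ht.2⟩))
    have key := le_mul_exp_of_hasDerivAt_le (C := -(1 + 2 * |H| + lam * L))
      (f := fun s => -(u s ^ 2 + u' s ^ 2))
      (f' := fun s => -(2 * u s * u' s + 2 * u' s * u'' s)) hs.2.le ?_ ?_ ?_
    · have h1 := exp_pos (-(1 + 2 * |H| + lam * L) * (t - s))
      have h2 : (u s ^ 2 + u' s ^ 2) * exp (-(1 + 2 * |H| + lam * L) * (t - s)) ≤ 0 := by
        linarith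
      have h3 : u s ^ 2 + u' s ^ 2 ≤ 0 := nonpos_of_mul_nonpos_left h2 h1
      exact pow_eq_zero_iff two_ne_zero |>.1 (by nlinarith [sq_nonneg (u s), sq_nonneg (u' s)])
    · exact (((hu.continuousOn.pow 2).add (hu.2.1.pow 2)).mono hsub).neg
    · intro x hx
      have hx : x ∈ Ioo 0 T := ⟨hs.1.trans hx.1, hx.2.trans_le ht.2⟩
      have h1 := (((hu.hasDerivAt hx).pow 2).add ((hu.hasDerivAt' hx).pow 2)).neg
      refine h1.congr_deriv ?_
      simp
    · intro x hx
      have hHx := (hH x (Ioo_subset_Icc_self hx)).trans (le_abs_self H)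
      have hx : x ∈ Ioo 0 T := ⟨hs.1.trans hx.1, hx.2.trans_le ht.2⟩
      have hxM := hM x (Ioo_subset_Icc_self hx)
      have hd := hLip (u x) 0 hxM (by simpa using (abs_nonneg _).trans hxM)
      rw [hu.eqn (Ioo_subset_Ioc_self hx)]
      simp only [mul_zero, sub_zero] at hd
      set A := |u x| ^ (q - 1) * u x - u x
      have h2 : u' x * A ≤ L * (|u x| * |u' x|) := by
        calc _ ≤ |u' x * A| := le_abs_self _
          _ = |u' x| * |A| := abs_mul _ _
          _ ≤ |u' x| * (L * |u x|) := by gcongr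
          _ = _ := by ring
      have h3 : 2 * (|u x| * |u' x|) ≤ u x ^ 2 + u' x ^ 2 := by
        rw [← sq_abs (u x), ← sq_abs (u' x)]
        nlinarith [sq_nonneg (|u x| - |u' x|)]
      have h4 : 0 ≤ u x ^ 2 + u' x ^ 2 + 2 * u x * u' x := by
        nlinarith [sq_nonneg (u x + u' x)]
      have h5 := mul_le_mul_of_nonneg_left h2 hlam.le
      have h6 := mul_le_mul_of_nonneg_left h3 (mul_nonneg hlam.le hL)
      have h7 : 0 ≤ (|H| - h x) * u' x ^ 2 :=
        mul_nonneg (sub_nonneg.2 ((le_abs_self _).trans hHx)) (sq_nonneg _)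
      have h8 : 0 ≤ |H| * u x ^ 2 := by positivity
      linear_combination h4 + 2 * h5 + h6 + 2 * h7 + 2 * h8
  have hcl : (0 : ℝ) ∈ closure (Ioo 0 t) := by
    rw [closure_Ioo ht0.ne]
    exact left_mem_Icc.2 ht0.le
  have hc : ContinuousWithinAt u (Ioo 0 t) 0 :=
    (hu.continuousOn 0 ⟨le_rfl, ht.1.trans ht.2⟩).mono
      (Ioo_subset_Icc_self.trans (Icc_subset_Icc_right ht.2))
  have hm := hc.mem_closure hcl (t := {0}) (fun s hs => hzero s hs)
  rw [closure_singleton] at hm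
  exact hu0 hm

end SolOn

/-- `θ` is a continuous angle on `[0, T]`, starting at `0`, for the plane curve `(u, v)`. -/
def IsAngleLift (T : ℝ) (u v θ : ℝ → ℝ) : Prop :=
  ContinuousOn θ (Icc 0 T) ∧ θ 0 = 0 ∧
    ∀ t ∈ Icc 0 T, ∃ r, 0 < r ∧ u t = r * cos (θ t) ∧ v t = r * sin (θ t)

theorem IsAngleLift.exists_of_inner_pos {T : ℝ} (hT : 0 < T) {u₁ v₁ u₂ v₂ θ : ℝ → ℝ}
    (hu₁ : ContinuousOn u₁ (Icc 0 T)) (hv₁ : ContinuousOn v₁ (Icc 0 T))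
    (hu₂ : ContinuousOn u₂ (Icc 0 T)) (hv₂ : ContinuousOn v₂ (Icc 0 T))
    (hv₁0 : v₁ 0 = 0) (hv₂0 : v₂ 0 = 0)
    (hpos : ∀ t ∈ Icc 0 T, 0 < u₁ t * u₂ t + v₁ t * v₂ t)
    (hθ : IsAngleLift T u₁ v₁ θ) {ψ : ℝ} (hψ : |ψ - θ T| < π / 2)
    (hψT : ∃ r, 0 < r ∧ u₂ T = r * cos ψ ∧ v₂ T = r * sin ψ) :
    ∃ θ', IsAngleLift T u₂ v₂ θ' ∧ θ' T = ψ := by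
  obtain ⟨hc, h0, hr⟩ := hθ
  refine ⟨fun t => θ t + arctan ((u₁ t * v₂ t - v₁ t * u₂ t) / (u₁ t * u₂ t + v₁ t * v₂ t)),
    ⟨?_, by simp [h0, hv₁0, hv₂0], ?_⟩, ?_⟩
  · refine hc.add (continuous_arctan.comp_continuousOn ?_)
    exact ((hu₁.mul hv₂).sub (hv₁.mul hu₂)).div ((hu₁.mul hu₂).add (hv₁.mul hv₂))
      fun t ht => (hpos t ht).ne'
  · intro t ht
    obtain ⟨r, hr0, h1, h2⟩ := hr t ht
    have hx := hpos t ht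
    dsimp only
    generalize hxdef : u₁ t * u₂ t + v₁ t * v₂ t = x at hx ⊢
    generalize hydef : u₁ t * v₂ t - v₁ t * u₂ t = y
    have hs : 0 < √(1 + (y / x) ^ 2) := sqrt_pos.2 (by positivity)
    have hcos : x = x * √(1 + (y / x) ^ 2) * cos (arctan (y / x)) := by
      rw [cos_arctan]
      field_simp
    have hsin : y = x * √(1 + (y / x) ^ 2) * sin (arctan (y / x)) := by
      rw [sin_arctan]
      field_simp
    have hρ : 0 < x * √(1 + (y / x) ^ 2) := by positivity
    generalize x * √(1 + (y / x) ^ 2) = ρ at hcos hsin hρ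
    generalize arctan (y / x) = δ at hcos hsin ⊢
    refine ⟨ρ / r, by positivity, ?_, ?_⟩
    · rw [cos_add]
      have h3 : r ^ 2 * u₂ t = r * (cos (θ t) * x - sin (θ t) * y) := by
        rw [← hxdef, ← hydef, h1, h2]
        linear_combination (-r ^ 2 * u₂ t) * (sin_sq_add_cos_sq (θ t))
      rw [hcos, hsin] at h3
      field_simp
      refine mul_left_cancel₀ hr0.ne' ?_
      linear_combination h3
    · rw [sin_add]
      have h3 : r ^ 2 * v₂ t = r * (sin (θ t) * x + cos (θ t) * y) := by
        rw [← hxdef, ← hydef, h1, h2]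
        linear_combination (-r ^ 2 * v₂ t) * (sin_sq_add_cos_sq (θ t))
      rw [hcos, hsin] at h3
      field_simp
      refine mul_left_cancel₀ hr0.ne' ?_
      linear_combination h3
  · have hTm : T ∈ Icc 0 T := right_mem_Icc.2 hT.le
    obtain ⟨r, hr0, h1, h2⟩ := hr T hTm
    obtain ⟨s, hs0, h3, h4⟩ := hψT
    obtain ⟨h5, h6⟩ := _root_.abs_lt.1 hψ
    have h7 : (u₁ T * v₂ T - v₁ T * u₂ T) / (u₁ T * u₂ T + v₁ T * v₂ T) = tan (ψ - θ T) := by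
      rw [tan_eq_sin_div_cos, sin_sub, cos_sub, h1, h2, h3, h4,
        ← mul_div_mul_left (sin ψ * cos (θ T) - _) _ (mul_pos hr0 hs0).ne']
      congr 1 <;> ring
    simp only [h7, arctan_tan (by linarith) h6]
    ring

theorem HasDerivWithinAt.eventually_neg_left {u : ℝ → ℝ} {m t : ℝ} (hu : HasDerivWithinAt u m (Iio t) t)
    (h0 : u t = 0) (hm : 0 < m) : ∀ᶠ s in 𝓝[<] t, u s < 0 := by
  have h1 := (hasDerivWithinAt_iff_tendsto_slope' (by simp)).1 hu
  filter_upwards [h1.eventually (lt_mem_nhds hm), self_mem_nhdsWithin] with s hs hst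
  have hst : s < t := hst
  rw [slope_def_field, h0, sub_zero] at hs
  by_contra! hle
  have := div_nonpos_of_nonneg_of_nonpos hle (sub_nonpos.2 hst.le)
  linarith

theorem HasDerivWithinAt.eventually_neg_right {u : ℝ → ℝ} {m t : ℝ} (hu : HasDerivWithinAt u m (Ioi t) t)
    (h0 : u t = 0) (hm : m < 0) : ∀ᶠ s in 𝓝[>] t, u s < 0 := by
  have h1 := (hasDerivWithinAt_iff_tendsto_slope' (by simp)).1 hu
  filter_upwards [h1.eventually (gt_mem_nhds hm), self_mem_nhdsWithin] with s hs hst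
  have hst : t < s := hst
  rw [slope_def_field, h0, sub_zero] at hs
  by_contra! hle
  have := div_nonneg hle (sub_nonneg.2 hst.le)
  linarith

/-- The phase curve `(u, u')` can only rotate clockwise through the vertical axis. -/
theorem IsAngleLift.lt_pi_div_two {T : ℝ} {u u' θ : ℝ → ℝ}
    (hu : ∀ t ∈ Icc 0 T, HasDerivWithinAt u (u' t) (Icc 0 T) t)
    (hθ : IsAngleLift T u u' θ) {t : ℝ} (ht : t ∈ Icc 0 T) : θ t < π / 2 := by
  obtain ⟨hc, h0, hr⟩ := hθ
  by_contra! hle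
  have hsub : Icc 0 t ⊆ Icc 0 T := Icc_subset_Icc_right ht.2
  have hS : IsCompact (Icc 0 t ∩ θ ⁻¹' {π / 2}) :=
    isCompact_Icc.of_isClosed_subset
      ((hc.mono hsub).preimage_isClosed_of_isClosed isClosed_Icc isClosed_singleton)
      inter_subset_left
  obtain ⟨s, hs, hsθ⟩ : π / 2 ∈ θ '' Icc 0 t :=
    intermediate_value_Icc ht.1 (hc.mono hsub) ⟨by rw [h0]; positivity, hle⟩
  obtain ⟨x, ⟨hx, hxθ⟩, hmin⟩ := hS.exists_isLeast ⟨s, hs, hsθ⟩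
  have hxθ : θ x = π / 2 := hxθ
  have hx0 : 0 < x := by
    rcases hx.1.eq_or_lt with rfl | h
    · rw [h0] at hxθ
      linarith [pi_pos]
    · exact h
  have hxT := hsub hx
  obtain ⟨r, hr0, h1, h2⟩ := hr x hxT
  rw [hxθ, cos_pi_div_two, mul_zero] at h1
  rw [hxθ, sin_pi_div_two, mul_one] at h2
  have hmem : Icc 0 T ∈ 𝓝[<] x :=
    mem_of_superset (Ioo_mem_nhdsLT hx0) fun y hy => ⟨hy.1.le, hy.2.le.trans hxT.2⟩
  have hd : HasDerivWithinAt u r (Iio x) x := h2 ▸ (hu x hxT).mono_of_mem_nhdsWithin hmem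
  have hcx : ContinuousWithinAt θ (Iio x) x := (hc x hxT).mono_of_mem_nhdsWithin hmem
  have hev : ∀ᶠ y in 𝓝[<] x, -(π / 2) < θ y :=
    hcx.eventually (lt_mem_nhds (by rw [hxθ]; linarith [pi_pos]))
  obtain ⟨y, hy1, hy2, hy3, hy4⟩ :=
    ((hd.eventually_neg_left h1 hr0).and
      (hev.and (Filter.Eventually.and (Ioo_mem_nhdsLT hx0) hmem))).exists
  have hyθ : θ y < π / 2 := by
    by_contra! hcon
    obtain ⟨z, hz, hzθ⟩ : π / 2 ∈ θ '' Icc 0 y :=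
      intermediate_value_Icc hy3.1.le (hc.mono (Icc_subset_Icc_right hy4.2))
        ⟨by rw [h0]; positivity, hcon⟩
    have := hmin ⟨⟨hz.1, hz.2.trans (hy3.2.le.trans hx.2)⟩, hzθ⟩
    linarith [hz.2, hy3.2]
  obtain ⟨ρ, hρ0, h3, -⟩ := hr y hy4
  have := mul_pos hρ0 (cos_pos_of_mem_Ioo ⟨hy2, hyθ⟩)
  linarith

theorem IsAngleLift.neg_pi_div_two_lt {T : ℝ} {u u' θ : ℝ → ℝ}
    (hu : ∀ t ∈ Icc 0 T, HasDerivWithinAt u (u' t) (Icc 0 T) t)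
    (hθ : IsAngleLift T u u' θ) (hT : -(π / 2) < θ T) {t : ℝ} (ht : t ∈ Icc 0 T) :
    -(π / 2) < θ t := by
  have hlt := fun s hs => hθ.lt_pi_div_two hu (t := s) hs
  obtain ⟨hc, h0, hr⟩ := hθ
  by_contra! hle
  have hsub : Icc t T ⊆ Icc 0 T := Icc_subset_Icc_left ht.1
  have hS : IsCompact (Icc t T ∩ θ ⁻¹' {-(π / 2)}) :=
    isCompact_Icc.of_isClosed_subset
      ((hc.mono hsub).preimage_isClosed_of_isClosed isClosed_Icc isClosed_singleton)
      inter_subset_left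
  obtain ⟨s, hs, hsθ⟩ : -(π / 2) ∈ θ '' Icc t T :=
    intermediate_value_Icc ht.2 (hc.mono hsub) ⟨hle, hT.le⟩
  obtain ⟨x, ⟨hx, hxθ⟩, hmax⟩ := hS.exists_isGreatest ⟨s, hs, hsθ⟩
  have hxθ : θ x = -(π / 2) := hxθ
  have hx0 : x < T := by
    rcases hx.2.eq_or_lt with rfl | h
    · linarith
    · exact h
  have hxT := hsub hx
  obtain ⟨r, hr0, h1, h2⟩ := hr x hxT
  rw [hxθ, cos_neg, cos_pi_div_two, mul_zero] at h1
  rw [hxθ, sin_neg, sin_pi_div_two, mul_neg, mul_one] at h2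
  have hmem : Icc 0 T ∈ 𝓝[>] x :=
    mem_of_superset (Ioo_mem_nhdsGT hx0) fun y hy => ⟨hxT.1.trans hy.1.le, hy.2.le⟩
  have hd : HasDerivWithinAt u (-r) (Ioi x) x := h2 ▸ (hu x hxT).mono_of_mem_nhdsWithin hmem
  obtain ⟨y, hy1, hy3, hy4⟩ :=
    ((hd.eventually_neg_right h1 (neg_lt_zero.2 hr0)).and
      (Filter.Eventually.and (Ioo_mem_nhdsGT hx0) hmem)).exists
  have hyθ : -(π / 2) < θ y := by
    by_contra! hcon
    obtain ⟨z, hz, hzθ⟩ : -(π / 2) ∈ θ '' Icc y T :=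
      intermediate_value_Icc hy3.2.le (hc.mono (Icc_subset_Icc_left hy4.1)) ⟨hcon, hT.le⟩
    have := hmax ⟨⟨hx.1.trans (hy3.1.le.trans hz.1), hz.2⟩, hzθ⟩
    linarith [hz.1, hy3.1]
  obtain ⟨ρ, hρ0, h3, -⟩ := hr y hy4
  have := mul_pos hρ0 (cos_pos_of_mem_Ioo ⟨hyθ, hlt y hy4⟩)
  linarith

/-- For a one-sided shooting family, the terminal angle, continued from the constant solution `1`,
is the total rotation of the phase curve. -/
theorem exists_isAngleLift {h : ℝ → ℝ} {lam q T : ℝ} (hT : 0 < T) (hlam : 0 < lam) (hq : 1 < q)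
    (hhc : ContinuousOn h (Ioc 0 T)) (hh : ∀ t ∈ Ioo 0 T, 0 ≤ h t) {U U' U'' : ℝ → ℝ → ℝ}
    (hU : ∀ s, SolOn h lam q (Icc 0 T) (Ioc 0 T) (U s) (U' s) (U'' s) ∧ U s 0 = s ∧ U' s 0 = 0)
    {a : ℝ → ℝ} (ha : ContinuousOn a (Ioi 0)) (ha1 : a 1 = 0)
    (haU : ∀ s, 0 < s → ∃ r, 0 ≤ r ∧ U s T = r * cos (a s) ∧ U' s T = r * sin (a s))
    {α : ℝ} (hα : 1 ≤ α) : ∃ θ, IsAngleLift T (U α) (U' α) θ ∧ θ T = a α := by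
  have hTm : T ∈ Icc 0 T := right_mem_Icc.2 hT.le
  have hne : ∀ s, 1 ≤ s → ∀ t ∈ Icc 0 T, 0 < U s t ^ 2 + U' s t ^ 2 := fun s hs t ht =>
    (hU s).1.sq_add_sq_pos hlam hq hhc (by rw [(hU s).2.1]; linarith) ht
  have haU' : ∀ s, 1 ≤ s → ∃ r, 0 < r ∧ U s T = r * cos (a s) ∧ U' s T = r * sin (a s) := by
    intro s hs
    obtain ⟨r, hr, h1, h2⟩ := haU s (by linarith)
    refine ⟨r, hr.lt_of_ne ?_, h1, h2⟩
    rintro rfl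
    have := hne s hs T hTm
    simp [h1, h2] at this
  have hbd : ∀ s ∈ Icc 1 α, ∀ t ∈ Icc 0 T, |U s t| ≤ α := by
    intro s hs t ht
    have h1 := (hU s).1.abs_le hlam hq hh (by rw [(hU s).2.1]; exact hs.1) (hU s).2.2 ht
    rw [(hU s).2.1] at h1
    exact h1.trans hs.2
  obtain ⟨L, hL, hLip⟩ := exists_lipschitz_abs_rpow_sub hq α
  have hdist : ∀ s ∈ Icc 1 α, ∀ s' ∈ Icc 1 α, ∀ t ∈ Icc 0 T,
      (U s t - U s' t) ^ 2 + (U' s t - U' s' t) ^ 2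
        ≤ (s - s') ^ 2 * exp ((1 + lam * L) * T) := by
    intro s hs s' hs' t ht
    have h1 := SolOn.dist_sq_le hlam hh hL hLip (hU s).1 (hU s').1 (hbd s hs) (hbd s' hs')
      (hU s).2.2 (hU s').2.2 ht
    rwa [(hU s).2.1, (hU s').2.1] at h1
  have hbase : ∃ θ, IsAngleLift T (U 1) (U' 1) θ ∧ θ T = a 1 := by
    have hone : SolOn h lam q (Icc 0 T) (Ioc 0 T) (fun _ => 1) (fun _ => 0) (fun _ => 0) :=
      ⟨fun t _ => hasDerivWithinAt_const t _ _, continuousOn_const,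
        fun t _ => hasDerivWithinAt_const t _ _, continuousOn_const, by simp⟩
    refine ⟨fun _ => 0, ⟨continuousOn_const, rfl, fun t ht => ⟨1, one_pos, ?_⟩⟩, ha1.symm⟩
    have h1 := SolOn.dist_sq_le hlam hh hL hLip (hU 1).1 hone (hbd 1 ⟨le_rfl, hα⟩)
      (fun t _ => by simpa using hα) (hU 1).2.2 rfl ht
    rw [(hU 1).2.1] at h1
    norm_num at h1 ⊢
    constructor <;> nlinarith [sq_nonneg (U 1 t - 1), sq_nonneg (U' 1 t)]
  have hstep : ∀ s s', 1 ≤ s' →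
      (∀ t ∈ Icc 0 T, 0 < U s t * U s' t + U' s t * U' s' t) → |a s' - a s| < π / 2 →
      (∃ θ, IsAngleLift T (U s) (U' s) θ ∧ θ T = a s) →
      ∃ θ, IsAngleLift T (U s') (U' s') θ ∧ θ T = a s' := by
    rintro s s' hs' hpos hlt ⟨θ, hθ, hθT⟩
    exact hθ.exists_of_inner_pos hT (hU s).1.continuousOn (hU s).1.2.1 (hU s').1.continuousOn
      (hU s').1.2.1 (hU s).2.2 (hU s').2.2 hpos (hθT ▸ hlt) (haU' s' hs')
  refine isPreconnected_Icc.induction₂' (s := Icc 1 α)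
    (fun s s' => (∃ θ, IsAngleLift T (U s) (U' s) θ ∧ θ T = a s) →
      ∃ θ, IsAngleLift T (U s') (U' s') θ ∧ θ T = a s') ?_ ?_
    (left_mem_Icc.2 hα) (right_mem_Icc.2 hα) hbase
  · intro s hs
    obtain ⟨x, hx, hmin⟩ := isCompact_Icc.exists_isMinOn ⟨T, hTm⟩
      (((hU s).1.continuousOn.pow 2).add ((hU s).1.2.1.pow 2))
    have hm : 0 < U s x ^ 2 + U' s x ^ 2 := hne s hs.1 x hx
    have hev1 : ∀ᶠ s' in 𝓝[Icc 1 α] s,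
        (s - s') ^ 2 * exp ((1 + lam * L) * T) < U s x ^ 2 + U' s x ^ 2 := by
      have hcont : Continuous fun s' => (s - s') ^ 2 * exp ((1 + lam * L) * T) := by fun_prop
      exact hcont.continuousWithinAt.eventually (gt_mem_nhds (by simpa using hm))
    have hev2 : ∀ᶠ s' in 𝓝[Icc 1 α] s, |a s' - a s| < π / 2 := by
      have hcont : ContinuousWithinAt (fun s' => |a s' - a s|) (Icc 1 α) s :=
        (((ha s (show 0 < s by linarith [hs.1])).mono
          fun y hy => show 0 < y by linarith [hy.1]).sub continuousWithinAt_const).abs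
      exact hcont.eventually (gt_mem_nhds (by simpa using pi_pos))
    filter_upwards [hev1, hev2, self_mem_nhdsWithin] with s' h1 h2 hs'
    have hpos : ∀ t ∈ Icc 0 T, 0 < U s t * U s' t + U' s t * U' s' t := by
      intro t ht
      have h3 := hdist s hs s' hs' t ht
      have h4 : U s x ^ 2 + U' s x ^ 2 ≤ U s t ^ 2 + U' s t ^ 2 := hmin ht
      nlinarith [sq_nonneg (U s' t), sq_nonneg (U' s' t)]
    refine ⟨hstep s s' hs'.1 hpos h2, hstep s' s hs.1 (fun t ht => ?_) ?_⟩
    · linarith [hpos t ht]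
    · rwa [abs_sub_comm]
  · intro x y z _ _ _ hxy hyz hx
    exact hyz (hxy hx)

theorem angle_lt_and_pos_of_lt {h : ℝ → ℝ} {lam q T : ℝ} (hT : 0 < T) (hlam : 0 < lam)
    (hq : 1 < q) (hhc : ContinuousOn h (Ioc 0 T)) (hh : ∀ t ∈ Ioo 0 T, 0 ≤ h t)
    {U U' U'' : ℝ → ℝ → ℝ}
    (hU : ∀ s, SolOn h lam q (Icc 0 T) (Ioc 0 T) (U s) (U' s) (U'' s) ∧ U s 0 = s ∧ U' s 0 = 0)
    {a : ℝ → ℝ} (ha : ContinuousOn a (Ioi 0)) (ha1 : a 1 = 0)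
    (haU : ∀ s, 0 < s → ∃ r, 0 ≤ r ∧ U s T = r * cos (a s) ∧ U' s T = r * sin (a s))
    {α : ℝ} (hα : 1 ≤ α) :
    a α < π / 2 ∧ (-(π / 2) < a α → ∀ t ∈ Icc 0 T, 0 < U α t) := by
  obtain ⟨θ, hθ, hθT⟩ := exists_isAngleLift hT hlam hq hhc hh hU ha ha1 haU hα
  have hd := (hU α).1.1
  refine ⟨hθT ▸ hθ.lt_pi_div_two hd (right_mem_Icc.2 hT.le), fun hlt t ht => ?_⟩
  obtain ⟨r, hr, h1, -⟩ := hθ.2.2 t ht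
  rw [h1]
  exact mul_pos hr (cos_pos_of_mem_Ioo
    ⟨hθ.neg_pi_div_two_lt hd (hθT ▸ hlt) ht, hθ.lt_pi_div_two hd ht⟩)

theorem SolOn.reflect {h : ℝ → ℝ} {lam q c d : ℝ} {v v' v'' : ℝ → ℝ}
    (hv : SolOn h lam q (Icc c d) (Ico c d) v v' v'') :
    SolOn (fun t => -h (d - t)) lam q (Icc 0 (d - c)) (Ioc 0 (d - c))
      (fun t => v (d - t)) (fun t => -v' (d - t)) (fun t => v'' (d - t)) := by
  obtain ⟨h1, h2, h3, h4, h5⟩ := hv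
  have hm1 : MapsTo (fun t => d - t) (Icc 0 (d - c)) (Icc c d) := fun t ht =>
    ⟨by linarith [ht.2], by linarith [ht.1]⟩
  have hm2 : MapsTo (fun t => d - t) (Ioc 0 (d - c)) (Ico c d) := fun t ht =>
    ⟨by linarith [ht.2], by linarith [ht.1]⟩
  have hid : ∀ (S : Set ℝ) t, HasDerivWithinAt (fun t => d - t) (-1) S t := fun S t =>
    ((hasDerivAt_id t).const_sub d).hasDerivWithinAt
  refine ⟨fun t ht => ?_, (h2.comp (by fun_prop) hm1).neg, fun t ht => ?_,
    h4.comp (by fun_prop) hm2, fun t ht => ?_⟩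
  · exact ((h1 _ (hm1 ht)).comp t (hid _ t) hm1).congr_deriv (by simp)
  · exact ((h3 _ (hm2 ht)).comp t (hid _ t) hm2).neg.congr_deriv (by simp)
  · linarith [h5 _ (hm2 ht)]

theorem continuousOn_ite_le {S : Set ℝ} {c : ℝ} {f g : ℝ → ℝ}
    (hf : ContinuousOn f (S ∩ Iic c)) (hg : ContinuousOn g (S ∩ Ici c)) (hfg : f c = g c) :
    ContinuousOn (fun t => if t ≤ c then f t else g t) S := by
  have hf' : ContinuousOn (fun t => if t ≤ c then f t else g t) (S ∩ Iic c) :=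
    hf.congr fun t ht => if_pos ht.2
  have hg' : ContinuousOn (fun t => if t ≤ c then f t else g t) (S ∩ Ici c) := by
    refine hg.congr fun t ht => ?_
    rcases (show c ≤ t from ht.2).eq_or_lt with rfl | hlt
    · simp [hfg]
    · simp [not_le.2 hlt]
  intro t ht
  rcases lt_trichotomy t c with hlt | rfl | hlt
  · exact (hf' t ⟨ht, hlt.le⟩).mono_of_mem_nhdsWithin
      (inter_mem self_mem_nhdsWithin (mem_nhdsWithin_of_mem_nhds (Iic_mem_nhds hlt)))
  · have := (hf' t ⟨ht, self_mem_Iic⟩).union (hg' t ⟨ht, self_mem_Ici⟩)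
    rwa [← inter_union_distrib_left, Iic_union_Ici, inter_univ] at this
  · exact (hg' t ⟨ht, hlt.le⟩).mono_of_mem_nhdsWithin
      (inter_mem self_mem_nhdsWithin (mem_nhdsWithin_of_mem_nhds (Ici_mem_nhds hlt)))

theorem hasDerivWithinAt_ite_le {S : Set ℝ} {c : ℝ} {f f' g g' : ℝ → ℝ}
    (hf : ∀ t ∈ S ∩ Iic c, HasDerivWithinAt f (f' t) (S ∩ Iic c) t)
    (hg : ∀ t ∈ S ∩ Ici c, HasDerivWithinAt g (g' t) (S ∩ Ici c) t)
    (hfg : f c = g c) (hfg' : f' c = g' c) {t : ℝ} (ht : t ∈ S) :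
    HasDerivWithinAt (fun t => if t ≤ c then f t else g t) (if t ≤ c then f' t else g' t) S t := by
  have hgeq : ∀ s, c ≤ s → (if s ≤ c then f s else g s) = g s := by
    intro s hs
    rcases hs.eq_or_lt with rfl | hlt
    · simp [hfg]
    · simp [not_le.2 hlt]
  have hf' : ∀ t ∈ S ∩ Iic c, HasDerivWithinAt (fun t => if t ≤ c then f t else g t) (f' t)
      (S ∩ Iic c) t := fun t ht =>
    (hf t ht).congr (fun s hs => if_pos hs.2) (if_pos ht.2)
  have hg' : ∀ t ∈ S ∩ Ici c, HasDerivWithinAt (fun t => if t ≤ c then f t else g t) (g' t)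
      (S ∩ Ici c) t := fun t ht =>
    (hg t ht).congr (fun s hs => hgeq s hs.2) (hgeq t ht.2)
  rcases lt_trichotomy t c with hlt | rfl | hlt
  · rw [if_pos hlt.le]
    exact (hf' t ⟨ht, hlt.le⟩).mono_of_mem_nhdsWithin
      (inter_mem self_mem_nhdsWithin (mem_nhdsWithin_of_mem_nhds (Iic_mem_nhds hlt)))
  · rw [if_pos le_rfl]
    have := (hf' t ⟨ht, self_mem_Iic⟩).union (hfg' ▸ hg' t ⟨ht, self_mem_Ici⟩)
    rwa [← inter_union_distrib_left, Iic_union_Ici, inter_univ] at this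
  · rw [if_neg (not_le.2 hlt)]
    exact (hg' t ⟨ht, hlt.le⟩).mono_of_mem_nhdsWithin
      (inter_mem self_mem_nhdsWithin (mem_nhdsWithin_of_mem_nhds (Ici_mem_nhds hlt)))

theorem SolOn.glue {h : ℝ → ℝ} {lam q c d : ℝ} {u u' u'' v v' v'' : ℝ → ℝ} (hc : c ∈ Ioo 0 d)
    (hu : SolOn h lam q (Icc 0 c) (Ioc 0 c) u u' u'')
    (hv : SolOn h lam q (Icc c d) (Ico c d) v v' v'') (huv : u c = v c) (huv' : u' c = v' c) :
    SolOn h lam q (Icc 0 d) (Ioo 0 d) (fun t => if t ≤ c then u t else v t)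
      (fun t => if t ≤ c then u' t else v' t) (fun t => if t ≤ c then u'' t else v'' t) := by
  have hI1 : Icc 0 d ∩ Iic c = Icc 0 c := by
    ext t
    exact ⟨fun ht => ⟨ht.1.1, ht.2⟩, fun ht => ⟨⟨ht.1, ht.2.trans hc.2.le⟩, ht.2⟩⟩
  have hI2 : Icc 0 d ∩ Ici c = Icc c d := by
    ext t
    exact ⟨fun ht => ⟨ht.2, ht.1.2⟩, fun ht => ⟨⟨hc.1.le.trans ht.1, ht.2⟩, ht.1⟩⟩
  have hI3 : Ioo 0 d ∩ Iic c = Ioc 0 c := by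
    ext t
    exact ⟨fun ht => ⟨ht.1.1, ht.2⟩, fun ht => ⟨⟨ht.1, ht.2.trans_lt hc.2⟩, ht.2⟩⟩
  have hI4 : Ioo 0 d ∩ Ici c = Ico c d := by
    ext t
    exact ⟨fun ht => ⟨ht.2, ht.1.2⟩, fun ht => ⟨⟨hc.1.trans_le ht.1, ht.2⟩, ht.1⟩⟩
  have huv'' : u'' c = v'' c := by
    rw [hu.eqn (right_mem_Ioc.2 hc.1), hv.eqn (left_mem_Ico.2 hc.2), huv, huv']
  refine ⟨fun t ht => hasDerivWithinAt_ite_le (hI1 ▸ hu.1) (hI2 ▸ hv.1) huv huv' ht,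
    continuousOn_ite_le (hI1 ▸ hu.2.1) (hI2 ▸ hv.2.1) huv',
    fun t ht => hasDerivWithinAt_ite_le (hI3 ▸ hu.2.2.1) (hI4 ▸ hv.2.2.1) huv' huv'' ht,
    continuousOn_ite_le (hI3 ▸ hu.2.2.2.1) (hI4 ▸ hv.2.2.2.1) huv'', fun t ht => ?_⟩
  rcases le_or_gt t c with hle | hlt
  · simp only [if_pos hle]
    exact hu.2.2.2.2 t ⟨ht.1, hle⟩
  · simp only [if_neg (not_le.2 hlt)]
    exact hv.2.2.2.2 t ⟨hlt.le, ht.2⟩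

end Helpers

theorem stmt_13
    (d lam : ℝ) (hd : 0 < d) (hlam : 0 < lam)
    (n m₁ m₂ : ℤ) (hn : 3 ≤ n)
    (hm₁0 : 0 ≤ m₁) (hm₁n : m₁ ≤ n - 2) (hm₂0 : 0 ≤ m₂) (hm₂n : m₂ ≤ n - 2)
    (h : ℝ → ℝ) (hC1 : ContDiffOn ℝ 1 h (Set.Ioo 0 d))
    (hder : ∀ t ∈ Set.Ioo 0 d, deriv h t < 0)
    (hlim0 : Filter.Tendsto (fun t => t * h t) (nhdsWithin 0 (Set.Ioi 0))
      (nhds ((n : ℝ) - (m₁ : ℝ) - 1)))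
    (hlimd : Filter.Tendsto (fun t => (t - d) * h t) (nhdsWithin d (Set.Iio d))
      (nhds ((n : ℝ) - (m₂ : ℝ) - 1)))
    (q : ℝ) (hq1 : 1 < q)
    (t₀ : ℝ) (ht₀ : t₀ ∈ Set.Ioo 0 d)
    (hpos : ∀ t ∈ Set.Ioo 0 t₀, 0 < h t) (hneg : ∀ t ∈ Set.Ioo t₀ d, h t < 0)
    (U U' U'' : ℝ → ℝ → ℝ)
    (hU : ∀ α : ℝ, SolOn h lam q (Set.Icc 0 t₀) (Set.Ioc 0 t₀) (U α) (U' α) (U'' α) ∧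
      U α 0 = α ∧ U' α 0 = 0)
    (hUuniq : ∀ α : ℝ, ∀ u u' u'' : ℝ → ℝ,
      SolOn h lam q (Set.Icc 0 t₀) (Set.Ioc 0 t₀) u u' u'' → u 0 = α → u' 0 = 0 →
      ∀ t ∈ Set.Icc 0 t₀, u t = U α t ∧ u' t = U' α t)
    (V V' V'' : ℝ → ℝ → ℝ)
    (hV : ∀ β : ℝ, SolOn h lam q (Set.Icc t₀ d) (Set.Ico t₀ d) (V β) (V' β) (V'' β) ∧
      V β d = β ∧ V' β d = 0)
    (hVuniq : ∀ β : ℝ, ∀ u u' u'' : ℝ → ℝ,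
      SolOn h lam q (Set.Icc t₀ d) (Set.Ico t₀ d) u u' u'' → u d = β → u' d = 0 →
      ∀ t ∈ Set.Icc t₀ d, u t = V β t ∧ u' t = V' β t)
    (a : ℝ → ℝ) (haCont : ContinuousOn a (Set.Ioi 0)) (ha1 : a 1 = 0)
    (haAngle : ∀ α : ℝ, 0 < α →
      U α t₀ = enorm2 (U α t₀, U' α t₀) * Real.cos (a α) ∧
      U' α t₀ = enorm2 (U α t₀, U' α t₀) * Real.sin (a α))
    (b : ℝ → ℝ) (hbCont : ContinuousOn b (Set.Ioi 0)) (hb1 : b 1 = 0)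
    (hbAngle : ∀ β : ℝ, 0 < β →
      V β t₀ = enorm2 (V β t₀, V' β t₀) * Real.cos (b β) ∧
      V' β t₀ = enorm2 (V β t₀, V' β t₀) * Real.sin (b β))
    (α β : ℝ) (hα : 1 < α) (hβ : 1 < β)
    (hab : a α = b β)
    (hnorm : enorm2 (U α t₀, U' α t₀) = enorm2 (V β t₀, V' β t₀)) :
    (U α t₀, U' α t₀) = (V β t₀, V' β t₀) ∧
    SolOn h lam q (Set.Icc 0 d) (Set.Ioo 0 d)
      (fun t => if t ≤ t₀ then U α t else V β t)
      (fun t => if t ≤ t₀ then U' α t else V' β t)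
      (fun t => if t ≤ t₀ then U'' α t else V'' β t) ∧
    (if (0 : ℝ) ≤ t₀ then U' α 0 else V' β 0) = 0 ∧
    (if d ≤ t₀ then U' α d else V' β d) = 0 ∧
    (∀ t ∈ Set.Icc 0 d, 0 < (if t ≤ t₀ then U α t else V β t)) := by
  obtain ⟨ha1', ha2'⟩ := haAngle α (by linarith)
  obtain ⟨hb1', hb2'⟩ := hbAngle β (by linarith)
  have hval : U α t₀ = V β t₀ := by rw [ha1', hb1', hab, hnorm]
  have hval' : U' α t₀ = V' β t₀ := by rw [ha2', hb2', hab, hnorm]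
  have hhc := hC1.continuousOn
  obtain ⟨hlt₁, hpos₁⟩ := angle_lt_and_pos_of_lt ht₀.1 hlam hq1
    (hhc.mono fun t ht => ⟨ht.1, ht.2.trans_lt ht₀.2⟩) (fun t ht => (hpos t ht).le) hU haCont ha1
    (fun s hs => ⟨_, Real.sqrt_nonneg _, haAngle s hs⟩) hα.le
  obtain ⟨hlt₂, hpos₂⟩ := angle_lt_and_pos_of_lt (h := fun t => -h (d - t)) (T := d - t₀)
    (U := fun s t => V s (d - t)) (U' := fun s t => -V' s (d - t))
    (U'' := fun s t => V'' s (d - t)) (a := fun s => -b s) (sub_pos.2 ht₀.2) hlam hq1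
    (hhc.comp (by fun_prop) fun t ht => ⟨by linarith [ht.2, ht₀.1], by linarith [ht.1]⟩).neg
    (fun t ht => neg_nonneg.2 (hneg (d - t) ⟨by linarith [ht.2], by linarith [ht.1]⟩).le)
    (fun s => ⟨(hV s).1.reflect, by simpa using (hV s).2.1, by simpa using (hV s).2.2⟩)
    hbCont.neg (by simp [hb1])
    (fun s hs => ⟨enorm2 (V s t₀, V' s t₀), Real.sqrt_nonneg _, by simpa using (hbAngle s hs).1,
      by simpa using (hbAngle s hs).2⟩) hβ.le
  refine ⟨by rw [hval, hval'], SolOn.glue ht₀ (hU α).1 (hV β).1 hval hval', ?_, ?_, ?_⟩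
  · rw [if_pos ht₀.1.le]
    exact (hU α).2.2
  · rw [if_neg (not_le.2 ht₀.2)]
    exact (hV β).2.2
  · intro t ht
    split_ifs with hle
    · exact hpos₁ (by linarith) t ⟨ht.1, hle⟩
    · have := hpos₂ (by linarith) (d - t) ⟨by linarith [ht.2], by linarith [not_le.1 hle]⟩
      simpa using this
end
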